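/- arXiv:2210.00566 — 5 statements merged into one kernel-verified Lean document; each statement's English description precedes it below -/
import Mathlib

section
/- Let k be a field, S a commutative ℕ-graded ring that is finitely generated as a k-algebra with S_0 = k, and let 𝔪 = S_{>0} be its irrelevant maximal ideal. Then for every finitely generated ℤ-graded S-module M, the graded free rank of M equals the free rank of the localization M_𝔪 as a module over the local ring S_𝔪. In particular, a finitely generated ℤ-graded S-module N has a graded free direct summand (a graded summand isomorphic to some shift S(j)) if and only if N_𝔪 has a direct summand isomorphic to S_𝔪. -/
section Defs

variable (S : Type*) [CommRing S] {ι : Type*} (M : Type*) [AddCommGroup M] [Module S M]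

/-- A submodule of a graded module is homogeneous (graded) when it is spanned by its
homogeneous elements. -/
def IsHomogeneousSubmodule (ℳ : ι → AddSubgroup M) (P : Submodule S M) : Prop :=
  P = Submodule.span S {x | x ∈ P ∧ ∃ d : ι, x ∈ ℳ d}

/-- The graded submodule `Q` has a graded free direct summand (a graded direct summand
isomorphic to a shift `S(j)` of `S`): there is a homogeneous element `u ∈ Q` with trivial
annihilator (so that `S·u ≅ S(-d)` as graded modules) together with a homogeneous complement
of `S·u` inside `Q`. -/
def HasGradedFreeSummand (ℳ : ι → AddSubgroup M) (Q : Submodule S M) : Prop :=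
  ∃ (u : M) (d : ι) (Q' : Submodule S M),
    u ∈ Q ∧ u ∈ ℳ d ∧ u ≠ 0 ∧ (∀ s : S, s • u = 0 → s = 0) ∧
    IsHomogeneousSubmodule S M ℳ Q' ∧ Q' ≤ Q ∧
    Submodule.span S {u} ⊓ Q' = ⊥ ∧ Submodule.span S {u} ⊔ Q' = Q

/-- The graded free rank of the graded module `M` is `r`: `M` is the direct sum of a graded
free submodule with a homogeneous basis of `r` elements (i.e. a sum `⊕_{t=1}^r S(-j_t)` of
shifts of `S`) and a homogeneous complement having no graded free direct summand. -/
def GradedFreeRankIs (ℳ : ι → AddSubgroup M) (r : ℕ) : Prop :=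
  ∃ (P Q : Submodule S M) (b : Fin r → M),
    IsCompl P Q ∧ IsHomogeneousSubmodule S M ℳ P ∧ IsHomogeneousSubmodule S M ℳ Q ∧
    (∀ t, ∃ d : ι, b t ∈ ℳ d) ∧ LinearIndependent S b ∧
    Submodule.span S (Set.range b) = P ∧
    ¬ HasGradedFreeSummand S M ℳ Q

/-- The submodule `Q` of the `R`-module `X` has a direct summand isomorphic to `R`: a
generator `u ∈ Q` with trivial annihilator (so `R·u ≅ R`) and a complement of `R·u` in `Q`. -/
def HasFreeSummandIn (R X : Type*) [CommRing R] [AddCommGroup X] [Module R X]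
    (Q : Submodule R X) : Prop :=
  ∃ (u : X) (Q' : Submodule R X),
    u ∈ Q ∧ u ≠ 0 ∧ (∀ r : R, r • u = 0 → r = 0) ∧ Q' ≤ Q ∧
    Submodule.span R {u} ⊓ Q' = ⊥ ∧ Submodule.span R {u} ⊔ Q' = Q

/-- The free rank of the `R`-module `X` is `a`: `X ≅ R^a ⊕ N` with `N` having no direct
summand isomorphic to `R`. -/
def FreeRankIs (R X : Type*) [CommRing R] [AddCommGroup X] [Module R X] (a : ℕ) : Prop :=
  ∃ (P Q : Submodule R X) (b : Fin a → X),
    IsCompl P Q ∧ LinearIndependent R b ∧ Submodule.span R (Set.range b) = P ∧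
    ¬ HasFreeSummandIn R X Q

end Defs

section Pairing

open Matrix

variable {R X : Type*} [CommRing R] [AddCommGroup X] [Module R X]

/-- There are `n` vectors and `n` functionals on `X` whose matrix of values has a determinant
outside `p`. For `p` the maximal ideal of a local ring this says that `X` has a free direct
summand of rank `n`. -/
def HasPairingOutside (p : Ideal R) (X : Type*) [AddCommGroup X] [Module R X] (n : ℕ) : Prop :=
  ∃ (φ : Fin n → X →ₗ[R] R) (x : Fin n → X), (of fun i j => φ i (x j)).det ∉ p

theorem hasPairingOutside_one_iff {p : Ideal R} :
    HasPairingOutside p X 1 ↔ ∃ (φ : X →ₗ[R] R) (x : X), φ x ∉ p := by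
  constructor
  · rintro ⟨φ, x, h⟩
    exact ⟨φ 0, x 0, by simpa using h⟩
  · rintro ⟨φ, x, h⟩
    exact ⟨fun _ => φ, fun _ => x, by simpa using h⟩

/-- A basis of a direct summand has dual functionals on the whole module. -/
theorem exists_dual_functionals {r : ℕ} {P Q : Submodule R X} {b : Fin r → X}
    (hPQ : IsCompl P Q) (hb : LinearIndependent R b)
    (hP : Submodule.span R (Set.range b) = P) :
    ∃ φ : Fin r → X →ₗ[R] R, ∀ i j, φ i (b j) = if i = j then 1 else 0 := by
  subst hP
  refine ⟨fun i => (Module.Basis.span hb).coord i ∘ₗ Submodule.projectionOnto _ Q hPQ,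
    fun i j => ?_⟩
  have hj : (⟨b j, Submodule.subset_span ⟨j, rfl⟩⟩ : Submodule.span R (Set.range b)) =
      Module.Basis.span hb j := (Module.Basis.span_apply hb j).symm
  rw [LinearMap.comp_apply, Submodule.projectionOnto_apply_of_mem_left hPQ
    (Submodule.subset_span ⟨j, rfl⟩), hj]
  simp [Finsupp.single_apply, eq_comm]

theorem hasPairingOutside_of_linearIndependent {p : Ideal R} (hp : p ≠ ⊤) {r : ℕ}
    {P Q : Submodule R X} {b : Fin r → X} (hPQ : IsCompl P Q) (hb : LinearIndependent R b)
    (hP : Submodule.span R (Set.range b) = P) : HasPairingOutside p X r := by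
  obtain ⟨φ, hφ⟩ := exists_dual_functionals hPQ hb hP
  refine ⟨φ, b, ?_⟩
  have h1 : (of fun i j => φ i (b j)) = (1 : Matrix (Fin r) (Fin r) R) := by
    ext i j
    simp [hφ, Matrix.one_apply]
  rw [h1, det_one]
  exact (Ideal.ne_top_iff_one p).mp hp

theorem le_of_hasPairingOutside {p : Ideal R} [p.IsPrime] {r n : ℕ}
    {P Q : Submodule R X} {b : Fin r → X} (hPQ : IsCompl P Q)
    (hP : Submodule.span R (Set.range b) = P) (hQ : ∀ φ : X →ₗ[R] R, ∀ q ∈ Q, φ q ∈ p)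
    (h : HasPairingOutside p X n) : n ≤ r := by
  obtain ⟨φ, x, hdet⟩ := h
  have hx : ∀ j, ∃ c : Fin r → R, x j - ∑ t, c t • b t ∈ Q := by
    intro j
    have hj : x j ∈ P ⊔ Q := by simp [hPQ.sup_eq_top]
    obtain ⟨y, hy, z, hz, hyz⟩ := Submodule.mem_sup.mp hj
    rw [← hP, Submodule.mem_span_range_iff_exists_fun] at hy
    obtain ⟨c, rfl⟩ := hy
    exact ⟨c, by rwa [← hyz, add_sub_cancel_left]⟩
  choose c hc using hx
  let f : R →+* FractionRing (R ⧸ p) :=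
    (algebraMap (R ⧸ p) (FractionRing (R ⧸ p))).comp (Ideal.Quotient.mk p)
  have hf : ∀ a, f a = 0 ↔ a ∈ p := fun a => by
    rw [RingHom.comp_apply, IsFractionRing.to_map_eq_zero_iff, Ideal.Quotient.eq_zero_iff_mem]
  let A : Matrix (Fin n) (Fin r) (FractionRing (R ⧸ p)) := of fun i t => f (φ i (b t))
  let B : Matrix (Fin r) (Fin n) (FractionRing (R ⧸ p)) := of fun t j => f (c j t)
  have hAB : f.mapMatrix (of fun i j => φ i (x j)) = A * B := by
    ext i j
    have h0 := (hf _).mpr (hQ (φ i) _ (hc j))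
    rw [map_sub, map_sub, sub_eq_zero] at h0
    simp [A, B, mul_apply, h0, mul_comm]
  have hunit : IsUnit (A * B) := by
    rw [isUnit_iff_isUnit_det, ← hAB, ← RingHom.map_det, isUnit_iff_ne_zero, Ne, hf]
    exact hdet
  calc n = (A * B).rank := by rw [rank_of_isUnit _ hunit, Fintype.card_fin]
    _ ≤ A.rank := rank_mul_le_left A B
    _ ≤ r := A.rank_le_width

theorem span_singleton_inf_ker_inf {φ : X →ₗ[R] R} {u : X} (hu : IsUnit (φ u))
    (Q : Submodule R X) : Submodule.span R {u} ⊓ (LinearMap.ker φ ⊓ Q) = ⊥ := by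
  rw [eq_bot_iff]
  rintro y ⟨hy, hy', -⟩
  obtain ⟨s, rfl⟩ := Submodule.mem_span_singleton.mp hy
  have hs : s * φ u = 0 := by simpa using hy'
  simp [hu.mul_left_eq_zero.mp hs]

theorem span_singleton_sup_ker_inf {φ : X →ₗ[R] R} {u : X} (hu : IsUnit (φ u))
    {Q : Submodule R X} (huQ : u ∈ Q) :
    Submodule.span R {u} ⊔ (LinearMap.ker φ ⊓ Q) = Q := by
  refine le_antisymm (sup_le (by simpa using huQ) inf_le_right) fun y hy => ?_
  obtain ⟨v, hv⟩ := hu.exists_left_inv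
  refine Submodule.mem_sup.mpr ⟨(φ y * v) • u, Submodule.mem_span_singleton.mpr ⟨_, rfl⟩,
    y - (φ y * v) • u, ⟨?_, Q.sub_mem hy (Q.smul_mem _ huQ)⟩, by abel⟩
  simp [mul_assoc, hv]

theorem eq_zero_of_smul_eq_zero_of_isUnit {φ : X →ₗ[R] R} {u : X} (hu : IsUnit (φ u)) {s : R}
    (hs : s • u = 0) : s = 0 :=
  hu.mul_left_eq_zero.mp (by simpa using congrArg φ hs)

theorem hasFreeSummandIn_of_isUnit [Nontrivial R] {φ : X →ₗ[R] R} {u : X} (hu : IsUnit (φ u))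
    {Q : Submodule R X} (huQ : u ∈ Q) : HasFreeSummandIn R X Q :=
  ⟨u, LinearMap.ker φ ⊓ Q, huQ, fun h => hu.ne_zero (by simp [h]),
    fun _ => eq_zero_of_smul_eq_zero_of_isUnit hu, inf_le_right,
    span_singleton_inf_ker_inf hu Q, span_singleton_sup_ker_inf hu huQ⟩

theorem hasPairingOutside_one_of_summand {p : Ideal R} (hp : p ≠ ⊤) {u : X}
    {Q : Submodule R X} (hu : ∀ s : R, s • u = 0 → s = 0)
    (hinf : Submodule.span R {u} ⊓ Q = ⊥) (hsup : Submodule.span R {u} ⊔ Q = ⊤) :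
    HasPairingOutside p X 1 := by
  refine hasPairingOutside_of_linearIndependent (b := fun _ => u) hp
    (IsCompl.of_eq hinf hsup) ?_ (by simp)
  rw [Fintype.linearIndependent_iff]
  intro g hg i
  rw [Subsingleton.elim i 0]
  exact hu _ (by simpa using hg)

end Pairing

section Localization

open Matrix

variable {R M : Type*} [CommRing R] [AddCommGroup M] [Module R M]

/-- For finitely presented modules, pairings with determinant outside a prime are the same as
pairings with invertible determinant over the local ring at this prime. -/
theorem hasPairingOutside_localization_iff (p : Ideal R) [p.IsPrime]
    [Module.FinitePresentation R M] (n : ℕ) :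
    HasPairingOutside (IsLocalRing.maximalIdeal (Localization.AtPrime p))
      (LocalizedModule p.primeCompl M) n ↔ HasPairingOutside p M n := by
  have hmem : ∀ a : R, algebraMap R (Localization.AtPrime p) a ∈
      IsLocalRing.maximalIdeal (Localization.AtPrime p) ↔ a ∈ p := fun a =>
    IsLocalization.AtPrime.to_map_mem_maximal_iff _ p a
  constructor
  · rintro ⟨φ, x, hdet⟩
    have hlift := fun i => Module.FinitePresentation.exists_lift_of_isLocalizedModule
      p.primeCompl (Algebra.linearMap R (Localization.AtPrime p))
      ((φ i).restrictScalars R ∘ₗ LocalizedModule.mkLinearMap p.primeCompl M)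
    choose ψ s hψ using hlift
    have hsurj := fun j => IsLocalizedModule.surj p.primeCompl
      (LocalizedModule.mkLinearMap p.primeCompl M) (x j)
    choose y hy using hsurj
    refine ⟨ψ, fun j => (y j).1, fun hmem' => hdet ?_⟩
    have hentry : ∀ i j, algebraMap R (Localization.AtPrime p) (ψ i (y j).1) =
        algebraMap R _ (s i : R) * (algebraMap R _ ((y j).2 : R) * φ i (x j)) := by
      intro i j
      have h1 := LinearMap.congr_fun (hψ i) (y j).1
      simp only [LinearMap.comp_apply, Algebra.linearMap_apply, LinearMap.smul_apply,
        LinearMap.restrictScalars_apply, ← hy j] at h1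
      rw [h1, Submonoid.smul_def, Submonoid.smul_def, ← LinearMap.restrictScalars_apply R,
        map_smul, LinearMap.restrictScalars_apply, Algebra.smul_def, Algebra.smul_def]
    have hdet' : algebraMap R (Localization.AtPrime p) (of fun i j => ψ i (y j).1).det =
        (∏ i, algebraMap R _ (s i : R)) * ((∏ j, algebraMap R _ ((y j).2 : R)) *
          (of fun i j => φ i (x j)).det) := by
      rw [← det_mul_row, ← det_mul_column, RingHom.map_det]
      congr 1
      ext i j
      exact hentry i j
    rw [← hmem, hdet', ← map_prod, ← map_prod] at hmem'
    have hprod : ∀ t : Fin n → p.primeCompl, ∏ i, (t i : R) ∉ p := fun t =>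
      prod_mem (S := p.primeCompl) fun i _ => (t i).2
    exact ((Ideal.IsPrime.mem_or_mem inferInstance ((Ideal.IsPrime.mem_or_mem inferInstance
      hmem').resolve_left (mt (hmem _).mp (hprod s)))).resolve_left
        (mt (hmem _).mp (hprod fun j => (y j).2)))
  · rintro ⟨φ, x, hdet⟩
    refine ⟨fun i => IsLocalizedModule.mapExtendScalars p.primeCompl
      (LocalizedModule.mkLinearMap p.primeCompl M)
      (Algebra.linearMap R (Localization.AtPrime p)) (Localization.AtPrime p) (φ i),
      fun j => LocalizedModule.mkLinearMap p.primeCompl M (x j), ?_⟩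
    rw [← hmem, RingHom.map_det] at hdet
    convert hdet using 3
    ext i j
    exact IsLocalizedModule.map_apply p.primeCompl (LocalizedModule.mkLinearMap p.primeCompl M)
      (Algebra.linearMap R (Localization.AtPrime p)) (φ i) (x j)

end Localization

section Graded

open DirectSum

variable {k S M : Type*} [CommRing k] [CommRing S] [Algebra k S]
  {𝒜 : ℕ → Submodule k S}
  [AddCommGroup M] [Module S M] {ℳ : ℤ → AddSubgroup M} [DirectSum.Decomposition ℳ]

theorem decompose_smul_of_mem
    (hcompat : ∀ (n : ℕ) (d : ℤ) (s : S) (x : M), s ∈ 𝒜 n → x ∈ ℳ d → s • x ∈ ℳ ((n : ℤ) + d))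
    {n : ℕ} {s : S} (hs : s ∈ 𝒜 n) (x : M) (i : ℤ) :
    (decompose ℳ (s • x) i : M) = s • (decompose ℳ x (i - n) : M) := by
  induction x using DirectSum.Decomposition.inductionOn ℳ with
  | zero => simp
  | add x y hx hy => simp [hx, hy]
  | @homogeneous j x =>
    have hsx := hcompat n j s x hs x.2
    rcases eq_or_ne ((n : ℤ) + j) i with rfl | hij
    · rw [decompose_of_mem_same ℳ hsx, add_sub_cancel_left, decompose_of_mem_same ℳ x.2]
    · rw [decompose_of_mem_ne ℳ hsx hij, decompose_of_mem_ne ℳ x.2 (by omega), smul_zero]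

variable (𝒜) [GradedAlgebra 𝒜]

/-- The homogeneous component of integral degree `z` in an `ℕ`-graded ring. -/
noncomputable def intProj (z : ℤ) : S →+ S :=
  if 0 ≤ z then GradedRing.proj 𝒜 z.toNat else 0

theorem intProj_mul {n : ℕ} {s : S} (hs : s ∈ 𝒜 n) (z : ℤ) (y : S) :
    intProj 𝒜 (n + z) (s * y) = s * intProj 𝒜 z y := by
  unfold intProj
  by_cases hz : 0 ≤ z
  · rw [if_pos hz, if_pos (by omega), GradedRing.proj_apply, GradedRing.proj_apply,
      coe_decompose_mul_of_left_mem_of_le 𝒜 hs (by omega)]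
    rw [show ((n : ℤ) + z).toNat - n = z.toNat by omega]
  · rw [if_neg hz]
    split_ifs with h
    · rw [GradedRing.proj_apply, coe_decompose_mul_of_left_mem_of_not_le 𝒜 hs (by omega)]
      simp
    · simp

theorem intProj_intProj (z : ℤ) (y : S) : intProj 𝒜 z (intProj 𝒜 z y) = intProj 𝒜 z y := by
  unfold intProj
  split_ifs
  · simp [GradedRing.proj_apply]
  · simp

theorem intProj_of_ne {z w : ℤ} (h : w ≠ z) (y : S) : intProj 𝒜 w (intProj 𝒜 z y) = 0 := by
  unfold intProj
  split_ifs
  · rw [GradedRing.proj_apply, GradedRing.proj_apply]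
    exact decompose_of_mem_ne 𝒜 (SetLike.coe_mem _) (by omega)
  all_goals simp

/-- The additive map underlying `gradedComponent`. -/
noncomputable def gradedComponentHom (ℳ : ℤ → AddSubgroup M) [DirectSum.Decomposition ℳ]
    (φ : M →ₗ[S] S) (e : ℤ) : M →+ S :=
  (DirectSum.toAddMonoid fun i =>
    ((intProj 𝒜 (i - e)).comp φ.toAddMonoidHom).comp (ℳ i).subtype).comp
      (decomposeAddEquiv ℳ).toAddMonoidHom

variable {𝒜}

theorem gradedComponentHom_of_mem (φ : M →ₗ[S] S) (e : ℤ) {i : ℤ} {x : M} (hx : x ∈ ℳ i) :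
    gradedComponentHom 𝒜 ℳ φ e x = intProj 𝒜 (i - e) (φ x) := by
  simp [gradedComponentHom, decompose_of_mem ℳ hx]

variable (𝒜) in
/-- The homogeneous component of degree `-e` of a functional on a graded module. -/
noncomputable def gradedComponent
    (hcompat : ∀ (n : ℕ) (d : ℤ) (s : S) (x : M), s ∈ 𝒜 n → x ∈ ℳ d → s • x ∈ ℳ ((n : ℤ) + d))
    (φ : M →ₗ[S] S) (e : ℤ) : M →ₗ[S] S where
  __ := gradedComponentHom 𝒜 ℳ φ e
  map_smul' s x := by
    change gradedComponentHom 𝒜 ℳ φ e (s • x) = s • gradedComponentHom 𝒜 ℳ φ e x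
    induction s using DirectSum.Decomposition.inductionOn 𝒜 with
    | zero => simp
    | add s t hs ht => rw [add_smul, map_add, hs, ht, add_smul]
    | @homogeneous n s =>
      induction x using DirectSum.Decomposition.inductionOn ℳ with
      | zero => simp
      | add x y hx hy => rw [smul_add, map_add, hx, hy, map_add, smul_add]
      | @homogeneous i x =>
        rw [gradedComponentHom_of_mem φ e (hcompat n i _ _ s.2 x.2),
          gradedComponentHom_of_mem φ e x.2, map_smul, smul_eq_mul, smul_eq_mul,
          add_sub_assoc, intProj_mul 𝒜 s.2]

theorem gradedComponent_of_mem
    (hcompat : ∀ (n : ℕ) (d : ℤ) (s : S) (x : M), s ∈ 𝒜 n → x ∈ ℳ d → s • x ∈ ℳ ((n : ℤ) + d))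
    (φ : M →ₗ[S] S) (e : ℤ) {i : ℤ} {x : M} (hx : x ∈ ℳ i) :
    gradedComponent 𝒜 hcompat φ e x = intProj 𝒜 (i - e) (φ x) :=
  gradedComponentHom_of_mem φ e hx

theorem intProj_gradedComponent
    (hcompat : ∀ (n : ℕ) (d : ℤ) (s : S) (x : M), s ∈ 𝒜 n → x ∈ ℳ d → s • x ∈ ℳ ((n : ℤ) + d))
    (φ : M →ₗ[S] S) (e i : ℤ) (x : M) :
    intProj 𝒜 (i - e) (gradedComponent 𝒜 hcompat φ e x) =
      gradedComponent 𝒜 hcompat φ e (decompose ℳ x i) := by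
  induction x using DirectSum.Decomposition.inductionOn ℳ with
  | zero => simp
  | add x y hx hy => simp [hx, hy]
  | @homogeneous j x =>
    rw [gradedComponent_of_mem hcompat φ e x.2]
    rcases eq_or_ne j i with rfl | hij
    · rw [intProj_intProj, decompose_of_mem_same ℳ x.2,
        gradedComponent_of_mem hcompat φ e x.2]
    · rw [intProj_of_ne 𝒜 (by omega), decompose_of_mem_ne ℳ x.2 hij, map_zero]

theorem IsHomogeneousSubmodule.decompose_mem
    (hcompat : ∀ (n : ℕ) (d : ℤ) (s : S) (x : M), s ∈ 𝒜 n → x ∈ ℳ d → s • x ∈ ℳ ((n : ℤ) + d))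
    {P : Submodule S M} (hP : IsHomogeneousSubmodule S M ℳ P) {x : M} (hx : x ∈ P) (i : ℤ) :
    (decompose ℳ x i : M) ∈ P := by
  rw [hP] at hx
  induction hx using Submodule.span_induction generalizing i with
  | mem x hx =>
    obtain ⟨hxP, d, hd⟩ := hx
    rcases eq_or_ne d i with rfl | hdi
    · rwa [decompose_of_mem_same ℳ hd]
    · rw [decompose_of_mem_ne ℳ hd hdi]
      exact P.zero_mem
  | zero => simp
  | add x y _ _ hx hy => simpa using P.add_mem (hx i) (hy i)
  | smul s x _ hx =>
    induction s using DirectSum.Decomposition.inductionOn 𝒜 with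
    | zero => simp
    | add s t hs ht => simpa [add_smul] using P.add_mem hs ht
    | @homogeneous n s =>
      rw [decompose_smul_of_mem hcompat s.2]
      exact P.smul_mem _ (hx _)

theorem isHomogeneousSubmodule_of_decompose_mem {P : Submodule S M}
    (hP : ∀ x ∈ P, ∀ i, (decompose ℳ x i : M) ∈ P) : IsHomogeneousSubmodule S M ℳ P := by
  classical
  refine le_antisymm (fun x hx => ?_) (Submodule.span_le.mpr fun x hx => hx.1)
  rw [← sum_support_decompose ℳ x]
  exact Submodule.sum_mem _ fun i _ => Submodule.subset_span ⟨hP x hx i, i, SetLike.coe_mem _⟩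

theorem isHomogeneousSubmodule_top : IsHomogeneousSubmodule S M ℳ (⊤ : Submodule S M) :=
  isHomogeneousSubmodule_of_decompose_mem fun _ _ _ => Submodule.mem_top

theorem isHomogeneousSubmodule_ker_gradedComponent_inf
    (hcompat : ∀ (n : ℕ) (d : ℤ) (s : S) (x : M), s ∈ 𝒜 n → x ∈ ℳ d → s • x ∈ ℳ ((n : ℤ) + d))
    (φ : M →ₗ[S] S) (e : ℤ) {Q : Submodule S M} (hQ : IsHomogeneousSubmodule S M ℳ Q) :
    IsHomogeneousSubmodule S M ℳ (LinearMap.ker (gradedComponent 𝒜 hcompat φ e) ⊓ Q) := by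
  refine isHomogeneousSubmodule_of_decompose_mem fun x hx i =>
    ⟨?_, hQ.decompose_mem hcompat hx.2 i⟩
  have hx' : gradedComponent 𝒜 hcompat φ e x = 0 := hx.1
  change gradedComponent 𝒜 hcompat φ e _ = 0
  rw [← intProj_gradedComponent hcompat, hx', map_zero]

end Graded

/-- A functional that takes a value outside the irrelevant ideal on a graded submodule splits
off a graded free summand from it. -/
theorem hasGradedFreeSummand_of_notMem_irrelevant
    {k S M : Type*} [Field k] [CommRing S] [Nontrivial S] [Algebra k S]
    {𝒜 : ℕ → Submodule k S} [GradedAlgebra 𝒜] (hS0 : 𝒜 0 = 1)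
    [AddCommGroup M] [Module S M] {ℳ : ℤ → AddSubgroup M} [DirectSum.Decomposition ℳ]
    (hcompat : ∀ (n : ℕ) (d : ℤ) (s : S) (x : M), s ∈ 𝒜 n → x ∈ ℳ d → s • x ∈ ℳ ((n : ℤ) + d))
    {Q : Submodule S M} (hQ : IsHomogeneousSubmodule S M ℳ Q) {φ : M →ₗ[S] S} {q : M}
    (hqQ : q ∈ Q) (hq : φ q ∉ (HomogeneousIdeal.irrelevant 𝒜).toIdeal) :
    HasGradedFreeSummand S M ℳ Q := by
  obtain ⟨u, ⟨huQ, e, hue⟩, hu⟩ :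
      ∃ u ∈ {x | x ∈ Q ∧ ∃ d : ℤ, x ∈ ℳ d}, φ u ∉ (HomogeneousIdeal.irrelevant 𝒜).toIdeal := by
    by_contra! hcon
    rw [hQ] at hqQ
    exact hq (Submodule.span_le
      (p := Submodule.comap φ (HomogeneousIdeal.irrelevant 𝒜).toIdeal) |>.mpr hcon hqQ)
  have hunit : IsUnit (gradedComponent 𝒜 hcompat φ e u) := by
    have hval : gradedComponent 𝒜 hcompat φ e u = GradedRing.proj 𝒜 0 (φ u) := by
      simp [gradedComponent_of_mem hcompat φ e hue, intProj]
    have hmem : GradedRing.proj 𝒜 0 (φ u) ∈ 𝒜 0 := by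
      rw [GradedRing.proj_apply]
      exact SetLike.coe_mem _
    rw [hS0, Submodule.mem_one] at hmem
    obtain ⟨c, hc⟩ := hmem
    rw [hval, ← hc]
    refine (IsUnit.mk0 c fun h0 => hu ?_).map (algebraMap k S)
    change φ u ∈ HomogeneousIdeal.irrelevant 𝒜
    rw [HomogeneousIdeal.mem_irrelevant_iff, ← hc, h0, map_zero]
  exact ⟨u, e, LinearMap.ker (gradedComponent 𝒜 hcompat φ e) ⊓ Q, huQ, hue,
    fun h => hunit.ne_zero (by simp [h]), fun _ => eq_zero_of_smul_eq_zero_of_isUnit hunit,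
    isHomogeneousSubmodule_ker_gradedComponent_inf hcompat φ e hQ, inf_le_right,
    span_singleton_inf_ker_inf hunit Q, span_singleton_sup_ker_inf hunit huQ⟩

/-- Let `k` be a field, `S` a commutative ℕ-graded ring, finitely generated as a `k`-algebra,
with `S₀ = k` (grading `𝒜` with `𝒜 0 = 1`), and let `𝔪 = S₊` be the irrelevant maximal
ideal.  For every finitely generated ℤ-graded `S`-module `M`, the graded free rank of `M`
equals the free rank of the localization `M_𝔪` over the local ring `S_𝔪`; in particular `M`
has a graded free direct summand if and only if `M_𝔪` has a direct summand isomorphic to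
`S_𝔪`. -/
theorem gradedFreeRank_eq_freeRank_of_localization
    {k S : Type*} [Field k] [CommRing S] [Algebra k S]
    (𝒜 : ℕ → Submodule k S) [GradedAlgebra 𝒜]
    (hS0 : 𝒜 0 = 1) (hfg : Algebra.FiniteType k S)
    [hprime : (HomogeneousIdeal.irrelevant 𝒜).toIdeal.IsPrime]
    (M : Type*) [AddCommGroup M] [Module S M] [Module.Finite S M]
    (ℳ : ℤ → AddSubgroup M) [DirectSum.Decomposition ℳ]
    (hcompat : ∀ (n : ℕ) (d : ℤ) (s : S) (x : M), s ∈ 𝒜 n → x ∈ ℳ d →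
      s • x ∈ ℳ ((n : ℤ) + d)) :
    (∀ r a : ℕ, GradedFreeRankIs S M ℳ r →
      FreeRankIs (Localization.AtPrime (HomogeneousIdeal.irrelevant 𝒜).toIdeal)
        (LocalizedModule (HomogeneousIdeal.irrelevant 𝒜).toIdeal.primeCompl M) a →
      r = a) ∧
    (HasGradedFreeSummand S M ℳ (⊤ : Submodule S M) ↔
      HasFreeSummandIn (Localization.AtPrime (HomogeneousIdeal.irrelevant 𝒜).toIdeal)
        (LocalizedModule (HomogeneousIdeal.irrelevant 𝒜).toIdeal.primeCompl M)
        (⊤ : Submodule _ _)) := by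
  have hnoeth : IsNoetherianRing S := Algebra.FiniteType.isNoetherianRing k S
  have hpres : Module.FinitePresentation S M := Module.finitePresentation_of_finite S M
  have hnontriv : Nontrivial S := nontrivial_of_ne (0 : S) 1
    fun h => hprime.one_notMem (h ▸ zero_mem _)
  have hloc := hasPairingOutside_localization_iff (M := M) (HomogeneousIdeal.irrelevant 𝒜).toIdeal
  have hmax := IsLocalRing.maximalIdeal.isMaximal
    (Localization.AtPrime (HomogeneousIdeal.irrelevant 𝒜).toIdeal)
  refine ⟨?_, ?_, ?_⟩
  · rintro r a ⟨P, Q, b, hPQ, -, hQ, -, hb, hspan, hno⟩ ⟨P', Q', b', hPQ', hb', hspan', hno'⟩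
    refine le_antisymm ?_ ?_
    · refine le_of_hasPairingOutside hPQ' hspan' (fun φ q hq => ?_)
        ((hloc r).mpr (hasPairingOutside_of_linearIndependent hprime.ne_top hPQ hb hspan))
      by_contra hmem
      exact hno' (hasFreeSummandIn_of_isUnit (IsLocalRing.notMem_maximalIdeal.mp hmem) hq)
    · refine le_of_hasPairingOutside hPQ hspan (fun φ q hq => ?_)
        ((hloc a).mp (hasPairingOutside_of_linearIndependent hmax.ne_top hPQ' hb' hspan'))
      by_contra hmem
      exact hno (hasGradedFreeSummand_of_notMem_irrelevant hS0 hcompat hQ hq hmem)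
  · rintro ⟨u, _, Q, -, -, -, hu, -, -, hinf, hsup⟩
    obtain ⟨φ, x, hx⟩ := hasPairingOutside_one_iff.mp
      ((hloc 1).mpr (hasPairingOutside_one_of_summand hprime.ne_top hu hinf hsup))
    exact hasFreeSummandIn_of_isUnit (IsLocalRing.notMem_maximalIdeal.mp hx) Submodule.mem_top
  · rintro ⟨u, Q, -, -, hu, -, hinf, hsup⟩
    obtain ⟨φ, x, hx⟩ := hasPairingOutside_one_iff.mp
      ((hloc 1).mp (hasPairingOutside_one_of_summand hmax.ne_top hu hinf hsup))
    exact hasGradedFreeSummand_of_notMem_irrelevant hS0 hcompat isHomogeneousSubmodule_top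
      Submodule.mem_top hx
end

section
/- Let (R, 𝔪) be a commutative local ring of prime characteristic p and let e ≥ 1 be an integer. Then the set I_e := { x ∈ R : there is no R-linear map φ : F^e_* R → R with φ(F^e_* x) = 1 } (equivalently, the set of x ∈ R such that the R-module map R → F^e_* R sending 1 to F^e_* x does not split) is an ideal of R. -/
/-- If an additive map satisfying `φ (r ^ n * s) = r * φ s` takes a unit value at `x`, then
rescaling it gives such a map with value `1` at `x`. -/
theorem exists_powSemilinear_eq_one_of_isUnit {R : Type*} [CommRing R] {n : ℕ} {x : R}
    {φ : R →+ R} (hφ : ∀ r s : R, φ (r ^ n * s) = r * φ s) (hx : IsUnit (φ x)) :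
    ∃ ψ : R →+ R, (∀ r s : R, ψ (r ^ n * s) = r * ψ s) ∧ ψ x = 1 := by
  obtain ⟨b, hb⟩ := hx.exists_left_inv
  refine ⟨(AddMonoidHom.mulLeft b).comp φ, fun r s => ?_, hb⟩
  simp only [AddMonoidHom.comp_apply, AddMonoidHom.coe_mulLeft, hφ, mul_left_comm]

/-- Let `(R, 𝔪)` be a commutative local ring of prime characteristic `p` and `e ≥ 1`.
The set of elements `x ∈ R` such that the `R`-module map `R → F^e_* R`, `1 ↦ F^e_* x`,
does not split (equivalently, there is no `R`-linear map `φ : F^e_* R → R` with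
`φ (F^e_* x) = 1`) is an ideal of `R`.  Here an `R`-linear map `F^e_* R → R` is encoded
as an additive map `φ : R →+ R` satisfying `φ (r ^ p ^ e * s) = r * φ s`. -/
theorem nonsplit_set_is_ideal
    {R : Type*} [CommRing R] [IsLocalRing R] (p : ℕ) [Fact p.Prime] [CharP R p]
    (e : ℕ) (he : 1 ≤ e) :
    ∃ I : Ideal R, (I : Set R) =
      {x : R | ¬ ∃ φ : R →+ R, (∀ r s : R, φ (r ^ p ^ e * s) = r * φ s) ∧ φ x = 1} := by
  refine ⟨⟨⟨⟨_, ?_⟩, ?_⟩, ?_⟩, rfl⟩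
  · rintro x y hx hy ⟨φ, hφ, h⟩
    rw [map_add] at h
    rcases IsLocalRing.isUnit_or_isUnit_of_add_one h with hu | hu
    · exact hx (exists_powSemilinear_eq_one_of_isUnit hφ hu)
    · exact hy (exists_powSemilinear_eq_one_of_isUnit hφ hu)
  · rintro ⟨φ, -, h⟩
    exact zero_ne_one ((map_zero φ).symm.trans h)
  · rintro c x hx ⟨φ, hφ, h⟩
    refine hx ⟨φ.comp (AddMonoidHom.mulLeft c), fun r s => ?_, h⟩
    simp only [AddMonoidHom.comp_apply, AddMonoidHom.coe_mulLeft, mul_left_comm c, hφ]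
end

section
/- Let k be an F-finite field of characteristic p > 0, S a commutative ℕ-graded ring with S_0 = k that is finitely generated as a k-algebra, and 𝔪 = S_{>0} its irrelevant maximal ideal. Fix e ≥ 1 and endow F^e_* S with the ℕ-grading given by (F^e_* S)_n = ⊕_{i=0}^{p^e−1} F^e_* S_{i + n p^e}, which makes it a finitely generated graded S-module. Then the graded free rank of F^e_* S as a graded S-module equals the free rank of F^e_*(S_𝔪) as a module over the local ring S_𝔪. -/
section Frobenius

/-- `FrobMod R p e` is `R` regarded as an `R`-module via restriction of scalars along the
`e`-th iterate of the Frobenius endomorphism `r ↦ r ^ p ^ e`, i.e. the module `F^e_* R`. -/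
def FrobMod (R : Type*) (_p _e : ℕ) : Type _ := R

instance (R : Type*) [CommRing R] (p e : ℕ) : AddCommGroup (FrobMod R p e) :=
  inferInstanceAs (AddCommGroup R)

/-- The `R`-module structure on `F^e_* R`: `r • F^e_* s = F^e_* (r ^ p ^ e * s)`. -/
noncomputable instance (R : Type*) [CommRing R] (p e : ℕ) [Fact p.Prime] [CharP R p] :
    Module R (FrobMod R p e) :=
  Module.compHom R (iterateFrobenius R p e)

/-- The tautological additive isomorphism `R ≃+ F^e_* R`, `r ↦ F^e_* r`. -/
def FrobMod.of (R : Type*) [CommRing R] (p e : ℕ) : R ≃+ FrobMod R p e :=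
  AddEquiv.refl R

/-- The ℕ-grading on `F^e_* S` induced by an ℕ-grading `𝒜` on `S`:
`(F^e_* S)_n = ⊕_{i=0}^{p^e−1} F^e_* S_{i + n p^e}`. -/
def frobGrading (S : Type*) [CommRing S] (𝒜 : ℕ → AddSubgroup S) (p e : ℕ) (n : ℕ) :
    AddSubgroup (FrobMod S p e) :=
  AddSubgroup.map (FrobMod.of S p e).toAddMonoidHom
    (⨆ i ∈ Finset.range (p ^ e), 𝒜 (i + n * p ^ e))

end Frobenius

section FreeSummands

open IsLocalRing

variable {R X : Type*} [CommRing R] [AddCommGroup X] [Module R X]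

/-- A functional with value `1` on `u ∈ Q` splits `R u` off `Q`. -/
lemma splits_of_apply_eq_one {Q : Submodule R X} {u : X} (hu : u ∈ Q) (φ : X →ₗ[R] R)
    (h : φ u = 1) :
    (∀ r : R, r • u = 0 → r = 0) ∧ Submodule.span R {u} ⊓ (Q ⊓ LinearMap.ker φ) = ⊥ ∧
      Submodule.span R {u} ⊔ (Q ⊓ LinearMap.ker φ) = Q := by
  refine ⟨fun r hr ↦ by simpa [h] using congrArg φ hr, ?_, le_antisymm ?_ ?_⟩
  · rw [eq_bot_iff]
    rintro x ⟨hx, -, hxφ⟩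
    obtain ⟨r, rfl⟩ := Submodule.mem_span_singleton.mp hx
    have : r = 0 := by simpa [h] using hxφ
    simp [this]
  · exact sup_le ((Submodule.span_singleton_le_iff_mem _ _).mpr hu) inf_le_left
  · intro x hx
    rw [← add_sub_cancel (φ x • u) x]
    exact Submodule.add_mem_sup
      (Submodule.smul_mem _ _ (Submodule.mem_span_singleton_self u))
      ⟨Q.sub_mem hx (Q.smul_mem _ hu), by simp [h]⟩

lemma hasFreeSummandIn_of_isUnit_apply [Nontrivial R] {Q : Submodule R X} {x : X} (hx : x ∈ Q)
    (φ : X →ₗ[R] R) (h : IsUnit (φ x)) : HasFreeSummandIn R X Q := by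
  obtain ⟨v, hv⟩ := h
  have hu : φ ((↑v⁻¹ : R) • x) = 1 := by simp [← hv]
  obtain ⟨h₁, h₂, h₃⟩ := splits_of_apply_eq_one (Q.smul_mem _ hx) φ hu
  exact ⟨_, _, Q.smul_mem _ hx, fun h0 ↦ by simp [h0] at hu, h₁, inf_le_left, h₂, h₃⟩

/-- Coordinate functionals of a free direct summand. -/
lemma exists_coordinates {ι : Type*} [Fintype ι] [DecidableEq ι] {P Q : Submodule R X} {b : ι → X}
    (hPQ : IsCompl P Q) (hb : LinearIndependent R b) (hP : Submodule.span R (Set.range b) = P) :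
    ∃ c : ι → X →ₗ[R] R, (∀ i j, c i (b j) = if i = j then 1 else 0) ∧
      ∀ x, x - ∑ i, c i x • b i ∈ Q := by
  subst hP
  refine ⟨fun i ↦ (Module.Basis.span hb).coord i ∘ₗ Submodule.projectionOnto _ _ hPQ, ?_, ?_⟩
  · intro i j
    have hj : b j = ((Module.Basis.span hb j : _) : X) := by
      simp [Module.Basis.span_apply]
    rw [LinearMap.comp_apply, hj, Submodule.projectionOnto_apply_left]
    simp [Finsupp.single_apply, eq_comm]
  · intro x
    have h := congrArg Subtype.val
      ((Module.Basis.span hb).sum_repr (Submodule.projectionOnto _ _ hPQ x))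
    have h' : ∑ i, ((Module.Basis.span hb).coord i ∘ₗ Submodule.projectionOnto _ _ hPQ) x • b i =
        (Submodule.projectionOnto _ _ hPQ x : X) := by
      rw [← h]
      simp [Module.Basis.span_apply]
    rw [h', ← Submodule.projectionOnto_apply_eq_zero_iff hPQ, map_sub, sub_eq_zero,
      Submodule.projectionOnto_apply_left]

/-- If `X` is spanned by `a` elements modulo elements on which every functional takes non-unit
values, a free direct summand of `X` has rank at most `a`. -/
lemma card_le_of_dual_families [IsLocalRing R] {ι κ : Type*} [Fintype ι] [Fintype κ]
    [DecidableEq κ] (b : ι → X) (c : ι → X →ₗ[R] R)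
    (hc : ∀ x, ∀ φ : X →ₗ[R] R, φ (x - ∑ i, c i x • b i) ∈ maximalIdeal R)
    (b' : κ → X) (c' : κ → X →ₗ[R] R) (hbc : ∀ i j, c' i (b' j) = if i = j then 1 else 0) :
    Fintype.card κ ≤ Fintype.card ι := by
  classical
  let A : Matrix κ ι (ResidueField R) := .of fun u s ↦ residue R (c' u (b s))
  let B : Matrix ι κ (ResidueField R) := .of fun s t ↦ residue R (c s (b' t))
  have hAB : A * B = 1 := by
    ext u t
    have h := (residue_eq_zero_iff _).mpr (hc (b' t) (c' u))
    rw [map_sub, map_sub, sub_eq_zero, hbc] at h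
    simp only [map_sum, map_smul, smul_eq_mul, map_mul] at h
    rw [Matrix.mul_apply, Matrix.one_apply]
    simp only [A, B, Matrix.of_apply]
    simp_rw [mul_comm (residue R (c' u _))]
    rw [← h]
    split_ifs <;> simp
  calc Fintype.card κ = (A * B).rank := by rw [hAB, Matrix.rank_one]
    _ ≤ A.rank := Matrix.rank_mul_le_left A B
    _ ≤ Fintype.card ι := A.rank_le_card_width

end FreeSummands

section Localization

variable {S M R X : Type*} [CommRing S] [AddCommGroup M] [Module S M]
  [CommRing R] [Algebra S R] [AddCommGroup X] [Module R X] [Module S X] [IsScalarTower S R X]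

open IsLocalRing in
/-- A free direct summand of a finitely presented module with complement `Q` such that all
functionals map `Q` into the prime `𝔭` computes the free rank of the localization at `𝔭`. -/
lemma eq_freeRank_of_isLocalizedModule (𝔭 : Ideal S) [𝔭.IsPrime] [IsLocalization.AtPrime R 𝔭]
    [Module.FinitePresentation S M] (f : M →ₗ[S] X) [IsLocalizedModule 𝔭.primeCompl f]
    {r a : ℕ} {P Q : Submodule S M} {b : Fin r → M} (hPQ : IsCompl P Q)
    (hb : LinearIndependent S b) (hP : Submodule.span S (Set.range b) = P)
    (hQ : ∀ φ : M →ₗ[S] S, ∀ x ∈ Q, φ x ∈ 𝔭) (ha : FreeRankIs R X a) : r = a := by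
  have : IsLocalRing R := IsLocalization.AtPrime.isLocalRing R 𝔭
  obtain ⟨P', Q', b', hPQ', hb', hP', hQ'⟩ := ha
  obtain ⟨c', hc'b', hc'Q⟩ := exists_coordinates hPQ' hb' hP'
  obtain ⟨c, hcb, hcQ⟩ := exists_coordinates hPQ hb hP
  let C : Fin r → X →ₗ[R] R := fun i ↦
    IsLocalizedModule.mapExtendScalars 𝔭.primeCompl f (Algebra.linearMap S R) R (c i)
  have hCf (i x) : C i (f x) = algebraMap S R (c i x) := by
    simp [C, IsLocalizedModule.mapExtendScalars_apply_apply, IsLocalizedModule.map_apply]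
  have hCb (i j) : C i (f (b j)) = if i = j then 1 else 0 := by
    rw [hCf, hcb]; split_ifs <;> simp
  have unit_smul (s : 𝔭.primeCompl) {y : R} (hy : (s : S) • y ∈ maximalIdeal R) :
      y ∈ maximalIdeal R := by
    rw [Algebra.smul_def] at hy
    exact (Ideal.unit_mul_mem_iff_mem _ (IsLocalization.map_units R s)).mp hy
  have hQf (φ : X →ₗ[R] R) (q : M) (hq : q ∈ Q) : φ (f q) ∈ maximalIdeal R := by
    obtain ⟨ψ, s, hψ⟩ := Module.FinitePresentation.exists_lift_of_isLocalizedModule 𝔭.primeCompl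
      (Algebra.linearMap S R) (φ.restrictScalars S ∘ₗ f)
    refine unit_smul s ?_
    have h : algebraMap S R (ψ q) = (s : S) • φ (f q) := LinearMap.congr_fun hψ q
    rw [← h]
    exact (IsLocalization.AtPrime.to_map_mem_maximal_iff R 𝔭 _).mpr (hQ ψ q hq)
  refine le_antisymm ?_ ?_
  · simpa using card_le_of_dual_families b' c'
      (fun x φ ↦ by_contra fun h ↦ hQ' (hasFreeSummandIn_of_isUnit_apply (hc'Q x) φ
        (by simpa using h))) (fun i ↦ f (b i)) C hCb
  · suffices h : ∀ x, ∀ φ : X →ₗ[R] R, φ (x - ∑ i, C i x • f (b i)) ∈ maximalIdeal R by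
      simpa using card_le_of_dual_families (fun i ↦ f (b i)) C h b' c' hc'b'
    intro x φ
    obtain ⟨⟨m, s⟩, hs⟩ := IsLocalizedModule.surj 𝔭.primeCompl f x
    refine unit_smul s ?_
    have hs' : (s : S) • x = f m := hs
    have hsum : (s : S) • (x - ∑ i, C i x • f (b i)) = f (m - ∑ i, c i m • b i) := by
      have (i : Fin r) : (s : S) • C i x • f (b i) = f (c i m • b i) := by
        rw [← smul_assoc, ← (C i).map_smul_of_tower, hs', hCf, map_smul, algebraMap_smul]
      rw [smul_sub, Finset.smul_sum, hs', map_sub, map_sum]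
      simp_rw [this]
    rw [← φ.map_smul_of_tower, hsum]
    exact hQf φ _ (hcQ m)

end Localization

section Graded

variable {k S M : Type*} [Field k] [CommRing S] [Nontrivial S] [Algebra k S] [AddCommGroup M]
  [Module S M]

/-- Suppose that every functional on `M` has homogeneous components. If some functional maps an
element of a homogeneous submodule `Q` outside the irrelevant ideal, then `Q` has a graded free
direct summand. -/
lemma hasGradedFreeSummand_of_apply_notMem_irrelevant (𝒜 : ℕ → Submodule k S) [GradedAlgebra 𝒜]
    (hS0 : 𝒜 0 = 1) (ℳ : ℕ → AddSubgroup M)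
    (hsmul : ∀ i j, ∀ s ∈ 𝒜 i, ∀ x ∈ ℳ j, s • x ∈ ℳ (i + j))
    (hcomp : ∀ (φ : M →ₗ[S] S) (d : ℕ), ∃ ψ : M →ₗ[S] S, ∀ n, ∀ x ∈ ℳ n,
      ψ x = if d ≤ n then (DirectSum.decompose 𝒜 (φ x) (n - d) : S) else 0)
    {Q : Submodule S M} (hQ : IsHomogeneousSubmodule S M ℳ Q) (φ : M →ₗ[S] S) {x : M}
    (hx : x ∈ Q) (hφx : φ x ∉ (HomogeneousIdeal.irrelevant 𝒜).toIdeal) :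
    HasGradedFreeSummand S M ℳ Q := by
  obtain ⟨u, huQ, d, hud, hu⟩ : ∃ u ∈ Q, ∃ d, u ∈ ℳ d ∧
      φ u ∉ (HomogeneousIdeal.irrelevant 𝒜).toIdeal := by
    by_contra! h
    refine hφx ?_
    have hle : Q ≤ Submodule.comap φ (HomogeneousIdeal.irrelevant 𝒜).toIdeal := by
      rw [hQ, Submodule.span_le]
      rintro y ⟨hy, d, hd⟩
      exact h y hy d hd
    exact hle hx
  obtain ⟨ψ, hψ⟩ := hcomp φ d
  obtain ⟨c, hc⟩ : ∃ c : k, algebraMap k S c = ψ u := by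
    have : ψ u ∈ 𝒜 0 := by
      rw [hψ d u hud, if_pos le_rfl, Nat.sub_self]
      exact SetLike.coe_mem _
    rwa [hS0, Submodule.mem_one] at this
  have hc0 : c ≠ 0 := by
    rintro rfl
    refine hu ?_
    rw [map_zero, hψ d u hud, if_pos le_rfl, Nat.sub_self] at hc
    change φ u ∈ HomogeneousIdeal.irrelevant 𝒜
    rw [HomogeneousIdeal.mem_irrelevant_iff, GradedRing.proj_apply]
    exact hc.symm
  let χ : M →ₗ[S] S := algebraMap k S c⁻¹ • ψ
  have hχu : χ u = 1 := by
    simp only [χ, LinearMap.smul_apply, ← hc, smul_eq_mul, ← map_mul, inv_mul_cancel₀ hc0, map_one]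
  have hχ (n) (y) (hy : y ∈ ℳ n) : χ y • u ∈ ℳ n := by
    simp only [χ, LinearMap.smul_apply, hψ n y hy]
    split_ifs with hdn
    · have := hsmul (n - d) d (c⁻¹ • (DirectSum.decompose 𝒜 (φ y) (n - d) : S))
        (Submodule.smul_mem _ _ (SetLike.coe_mem _)) u hud
      rwa [Nat.sub_add_cancel hdn, Algebra.smul_def] at this
    · simp
  obtain ⟨h₁, h₂, h₃⟩ := splits_of_apply_eq_one huQ χ hχu
  refine ⟨u, d, Q ⊓ LinearMap.ker χ, huQ, hud, fun h ↦ by simp [h] at hχu, h₁,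
    le_antisymm ?_ (Submodule.span_le.mpr fun y hy ↦ hy.1), inf_le_left, h₂, h₃⟩
  let T : M →ₗ[S] M := LinearMap.id - χ.smulRight u
  have hT : Q ≤ (Submodule.span S {y | y ∈ Q ⊓ LinearMap.ker χ ∧ ∃ d, y ∈ ℳ d}).comap T := by
    rw [hQ, Submodule.span_le, ← hQ]
    rintro y ⟨hy, n, hn⟩
    refine Submodule.subset_span ⟨⟨Q.sub_mem hy (Q.smul_mem _ huQ), ?_⟩, n,
      (ℳ n).sub_mem hn (hχ n y hn)⟩
    simp [T, hχu]
  rintro y ⟨hy, hyχ⟩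
  have : T y = y := by simp [T, LinearMap.mem_ker.mp hyχ]
  simpa [this] using hT hy

end Graded

section FrobMod

variable {S : Type*} [CommRing S] (p e : ℕ) [Fact p.Prime] [CharP S p]

lemma FrobMod.smul_of (s x : S) : s • FrobMod.of S p e x = FrobMod.of S p e (s ^ p ^ e * x) := rfl

lemma iterateFrobenius_finite_of_finite_frobMod [Module.Finite S (FrobMod S p 1)] :
    (iterateFrobenius S p e).Finite := by
  have h1 : (iterateFrobenius S p 1).Finite := ‹Module.Finite S (FrobMod S p 1)›
  induction e with
  | zero => rw [iterateFrobenius_zero]; exact RingHom.Finite.id S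
  | succ n ih => rw [iterateFrobenius_add]; exact ih.comp h1

lemma finite_frobMod_of_finiteType {k : Type*} [Field k] [CharP k p] [Algebra k S]
    [Module.Finite k (FrobMod k p 1)] [Algebra.FiniteType k S] :
    Module.Finite S (FrobMod S p e) := by
  have hft : ((algebraMap k S).comp (iterateFrobenius k p e)).FiniteType :=
    RingHom.FiniteType.comp ((RingHom.finiteType_algebraMap).mpr inferInstance)
      (iterateFrobenius_finite_of_finite_frobMod p e).finiteType
  rw [RingHom.iterateFrobenius_comm] at hft
  have hint : (iterateFrobenius S p e).IsIntegral := fun x ↦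
    ⟨Polynomial.X ^ p ^ e - Polynomial.C x,
      Polynomial.monic_X_pow_sub_C x (pow_pos (Fact.out : p.Prime).pos e).ne',
      by simp [iterateFrobenius_def]⟩
  exact hint.to_finite hft.of_comp_finiteType

variable {k : Type*} [Field k] [Algebra k S] (𝒜 : ℕ → Submodule k S)

omit [CharP S p] in
lemma frobGrading_induction {n : ℕ} {motive : FrobMod S p e → Prop} {x : FrobMod S p e}
    (hx : x ∈ frobGrading S (fun n ↦ (𝒜 n).toAddSubgroup) p e n)
    (of : ∀ j, j / p ^ e = n → ∀ y ∈ 𝒜 j, motive (FrobMod.of S p e y))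
    (zero : motive 0) (add : ∀ x y, motive x → motive y → motive (x + y)) : motive x := by
  obtain ⟨y, hy, rfl⟩ := hx
  have hq : 0 < p ^ e := pow_pos (Fact.out : p.Prime).pos e
  refine AddSubgroup.iSup_induction _ (C := fun y ↦ motive (FrobMod.of S p e y)) hy
    (fun i y hy ↦ ?_) zero fun x y hx hy ↦ add _ _ hx hy
  refine AddSubgroup.iSup_induction _ (C := fun y ↦ motive (FrobMod.of S p e y)) hy
    (fun hi y hy ↦ ?_) zero fun x y hx hy ↦ add _ _ hx hy
  refine of (i + n * p ^ e) ?_ y hy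
  rw [Nat.add_mul_div_right _ _ hq, Nat.div_eq_of_lt (Finset.mem_range.mp hi), zero_add]

omit [CharP S p] in
lemma of_mem_frobGrading {j : ℕ} {x : S} (hx : x ∈ 𝒜 j) :
    FrobMod.of S p e x ∈ frobGrading S (fun n ↦ (𝒜 n).toAddSubgroup) p e (j / p ^ e) := by
  have hq : 0 < p ^ e := pow_pos (Fact.out : p.Prime).pos e
  refine ⟨x, ?_, rfl⟩
  refine AddSubgroup.mem_iSup_of_mem (j % p ^ e) (AddSubgroup.mem_iSup_of_mem
    (Finset.mem_range.mpr (Nat.mod_lt _ hq)) ?_)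
  change x ∈ 𝒜 _
  rwa [mul_comm, Nat.mod_add_div]

variable [GradedAlgebra 𝒜]

lemma smul_mem_frobGrading (i j : ℕ) (s : S) (hs : s ∈ 𝒜 i) (x : FrobMod S p e)
    (hx : x ∈ frobGrading S (fun n ↦ (𝒜 n).toAddSubgroup) p e j) :
    s • x ∈ frobGrading S (fun n ↦ (𝒜 n).toAddSubgroup) p e (i + j) := by
  have hq : 0 < p ^ e := pow_pos (Fact.out : p.Prime).pos e
  refine frobGrading_induction p e 𝒜 (motive := fun x ↦ s • x ∈ _) hx
    (fun l hl y hy ↦ ?_) (by simp) fun x y hx hy ↦ ?_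
  · have := of_mem_frobGrading p e 𝒜 (SetLike.mul_mem_graded (SetLike.pow_mem_graded (p ^ e) hs) hy)
    rwa [smul_eq_mul, Nat.mul_add_div hq, hl] at this
  · rw [smul_add]; exact add_mem hx hy

/-- The homogeneous component of degree `-d` of a functional on `F^e_* S`. -/
lemma exists_homogeneous_component_frobMod (φ : FrobMod S p e →ₗ[S] S) (d : ℕ) :
    ∃ ψ : FrobMod S p e →ₗ[S] S, ∀ n, ∀ x ∈ frobGrading S (fun n ↦ (𝒜 n).toAddSubgroup) p e n,
      ψ x = if d ≤ n then (DirectSum.decompose 𝒜 (φ x) (n - d) : S) else 0 := by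
  have hq : 0 < p ^ e := pow_pos (Fact.out : p.Prime).pos e
  let g (j : ℕ) : 𝒜 j →+ S := if d ≤ j / p ^ e then
    (GradedRing.proj 𝒜 (j / p ^ e - d)).comp (φ.toAddMonoidHom.comp
      ((FrobMod.of S p e).toAddMonoidHom.comp (𝒜 j).subtype.toAddMonoidHom)) else 0
  let Ψ : S →+ S :=
    (DirectSum.toAddMonoid g).comp (DirectSum.decomposeAddEquiv 𝒜).toAddMonoidHom
  have hΨ (j) (y) (hy : y ∈ 𝒜 j) : Ψ y = if d ≤ j / p ^ e then
      (DirectSum.decompose 𝒜 (φ (FrobMod.of S p e y)) (j / p ^ e - d) : S) else 0 := by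
    have : Ψ y = g j ⟨y, hy⟩ := by
      simp [Ψ, DirectSum.decompose_of_mem 𝒜 hy]
    rw [this]
    simp only [g]
    split_ifs <;> simp [GradedRing.proj_apply]
  have hΨsmul (s y : S) : Ψ (s ^ p ^ e * y) = s * Ψ y := by
    induction y using DirectSum.Decomposition.inductionOn 𝒜 with
    | zero => simp
    | add y z hy hz => rw [mul_add, map_add, hy, hz, map_add, mul_add]
    | @homogeneous j y =>
      induction s using DirectSum.Decomposition.inductionOn 𝒜 with
      | zero => rw [zero_pow hq.ne', zero_mul, map_zero, zero_mul]
      | add s t hs ht => rw [add_pow_char_pow, add_mul, map_add, hs, ht, add_mul]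
      | @homogeneous i s =>
        rw [hΨ _ _ (SetLike.mul_mem_graded (SetLike.pow_mem_graded (p ^ e) s.2) y.2),
          hΨ _ _ y.2, smul_eq_mul, Nat.mul_add_div hq,
          ← FrobMod.smul_of, map_smul, smul_eq_mul]
        by_cases hd : d ≤ j / p ^ e
        · rw [if_pos hd, if_pos (by omega), Nat.add_sub_assoc hd,
            DirectSum.coe_decompose_mul_add_of_left_mem 𝒜 s.2]
        · rw [if_neg hd, mul_zero]
          split_ifs
          · exact DirectSum.coe_decompose_mul_of_left_mem_of_not_le 𝒜 s.2 (by omega)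
          · rfl
  refine ⟨{ toFun := fun x ↦ Ψ x, map_add' := Ψ.map_add, map_smul' := hΨsmul }, fun n x hx ↦ ?_⟩
  refine frobGrading_induction p e 𝒜 (motive := fun x ↦ (_ : S) =
    if d ≤ n then (DirectSum.decompose 𝒜 (φ x) (n - d) : S) else 0) hx
    (fun l hl y hy ↦ ?_) ?_ fun x y hx hy ↦ ?_
  · subst hl; exact hΨ l y hy
  · split_ifs <;> simp
  · rw [map_add, hx, hy]; split_ifs <;> simp

end FrobMod

section FrobModLocalization

variable {S : Type*} [CommRing S] (p e : ℕ) [Fact p.Prime] [CharP S p]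
  (R : Type*) [CommRing R] [Algebra S R] [CharP R p]
  [Module S (FrobMod R p e)] [IsScalarTower S R (FrobMod R p e)]

omit [CharP S p] in
lemma FrobMod.smul_of_of_isScalarTower (s : S) (x : R) :
    s • FrobMod.of R p e x = FrobMod.of R p e (algebraMap S R s ^ p ^ e * x) := by
  rw [← algebraMap_smul R s, FrobMod.smul_of]

/-- `F^e_*` of the structure map of an algebra. -/
noncomputable def FrobMod.mapAlgebra : FrobMod S p e →ₗ[S] FrobMod R p e where
  toFun x := FrobMod.of R p e (algebraMap S R ((FrobMod.of S p e).symm x))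
  map_add' x y := by simp
  map_smul' s x := by
    obtain ⟨x, rfl⟩ := (FrobMod.of S p e).surjective x
    simp [FrobMod.smul_of, FrobMod.smul_of_of_isScalarTower]

lemma FrobMod.isLocalizedModule_mapAlgebra (W : Submonoid S) [IsLocalization W R] :
    IsLocalizedModule W (FrobMod.mapAlgebra (S := S) p e R) where
  map_units s := by
    have h := (IsLocalization.map_units R s).map (Module.toModuleEnd R (FrobMod R p e))
    rw [Module.End.isUnit_iff] at h ⊢
    convert h using 1
    ext x
    exact (algebraMap_smul R (s : S) x).symm
  surj y := by
    obtain ⟨y, rfl⟩ := (FrobMod.of R p e).surjective y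
    obtain ⟨⟨x, s⟩, h⟩ := IsLocalization.surj W y
    refine ⟨⟨FrobMod.of S p e (s ^ (p ^ e - 1) * x), s⟩, ?_⟩
    refine (FrobMod.smul_of_of_isScalarTower p e R (s : S) y).trans (congrArg (FrobMod.of R p e) ?_)
    rw [AddEquiv.symm_apply_apply, map_mul, map_pow, ← h,
      ← pow_sub_one_mul (pow_pos (Fact.out : p.Prime).pos e).ne']
    ring
  exists_of_eq {x y} h := by
    obtain ⟨x, rfl⟩ := (FrobMod.of S p e).surjective x
    obtain ⟨y, rfl⟩ := (FrobMod.of S p e).surjective y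
    obtain ⟨c, hc⟩ := IsLocalization.exists_of_eq (M := W) ((FrobMod.of R p e).injective h)
    refine ⟨c, ?_⟩
    rw [AddEquiv.symm_apply_apply, AddEquiv.symm_apply_apply] at hc
    rw [Submonoid.smul_def, Submonoid.smul_def, FrobMod.smul_of, FrobMod.smul_of,
      ← pow_sub_one_mul (pow_pos (Fact.out : p.Prime).pos e).ne', mul_assoc, mul_assoc, hc]

end FrobModLocalization

/-- Let `k` be an F-finite field of characteristic `p > 0` (`F_* k` is a finite `k`-module),
`S` a commutative ℕ-graded ring with `S₀ = k`, finitely generated as a `k`-algebra, and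
`𝔪 = S₊` the irrelevant maximal ideal.  Fix `e ≥ 1` and endow `F^e_* S` with the ℕ-grading
`(F^e_* S)_n = ⊕_{i=0}^{p^e−1} F^e_* S_{i+np^e}`.  Then the graded free rank of `F^e_* S` as
a graded `S`-module equals the free rank of `F^e_*(S_𝔪)` as a module over the local ring
`S_𝔪`. -/
theorem gradedFreeRank_frobenius_eq_freeRank_of_localization
    {k S : Type*} [Field k] [CommRing S] [Algebra k S]
    (p : ℕ) [Fact p.Prime] [CharP k p] [CharP S p]
    (hFfinite : Module.Finite k (FrobMod k p 1))
    (𝒜 : ℕ → Submodule k S) [GradedAlgebra 𝒜]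
    (hS0 : 𝒜 0 = 1) (hfg : Algebra.FiniteType k S)
    [hprime : (HomogeneousIdeal.irrelevant 𝒜).toIdeal.IsPrime]
    [CharP (Localization.AtPrime (HomogeneousIdeal.irrelevant 𝒜).toIdeal) p]
    (e : ℕ) (he : 1 ≤ e) (r a : ℕ)
    (hr : GradedFreeRankIs S (FrobMod S p e)
      (frobGrading S (fun n => (𝒜 n).toAddSubgroup) p e) r)
    (ha : FreeRankIs (Localization.AtPrime (HomogeneousIdeal.irrelevant 𝒜).toIdeal)
      (FrobMod (Localization.AtPrime (HomogeneousIdeal.irrelevant 𝒜).toIdeal) p e) a) :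
    r = a := by
  have : Nontrivial S := CharP.nontrivial_of_char_ne_one (Fact.out : p.Prime).ne_one
  have : Module.Finite S (FrobMod S p e) := finite_frobMod_of_finiteType (k := k) p e
  have : IsNoetherianRing S := Algebra.FiniteType.isNoetherianRing k S
  have : Module.FinitePresentation S (FrobMod S p e) := Module.finitePresentation_of_finite _ _
  obtain ⟨P, Q, b, hPQ, -, hQ, -, hb, hP, hQfree⟩ := hr
  set 𝔪 := (HomogeneousIdeal.irrelevant 𝒜).toIdeal with h𝔪
  let R := Localization.AtPrime 𝔪
  let : Module S (FrobMod R p e) := Module.compHom _ (algebraMap S R)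
  have : IsScalarTower S R (FrobMod R p e) := ⟨fun x y z ↦ by
    rw [Algebra.smul_def, mul_smul]; rfl⟩
  have := FrobMod.isLocalizedModule_mapAlgebra (S := S) p e R 𝔪.primeCompl
  refine eq_freeRank_of_isLocalizedModule 𝔪 (FrobMod.mapAlgebra (S := S) p e R) hPQ hb hP ?_ ha
  intro φ x hx
  by_contra h
  exact hQfree (hasGradedFreeSummand_of_apply_notMem_irrelevant 𝒜 hS0 _
    (smul_mem_frobGrading p e 𝒜) (exists_homogeneous_component_frobMod p e 𝒜) hQ φ hx h)
end

section
/- Let (R, 𝔪) be a commutative local ring of prime characteristic p, e ≥ 1 an integer, and M an R-module. Suppose f = r_1 m_1 + ⋯ + r_s m_s with r_1, …, r_s ∈ R and m_1, …, m_s ∈ M, and suppose there exists an R-linear map ψ : F^e_* M → R with ψ(F^e_* f) = 1. Then there exists an index i and an R-linear map φ : F^e_* R → R with φ(F^e_* r_i) = 1; that is, if the map R → F^e_* M sending 1 to F^e_* f splits, then for some i the map R → F^e_* R sending 1 to F^e_* r_i splits. -/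
/-- Let `(R, 𝔪)` be a commutative local ring of prime characteristic `p`, `e ≥ 1`, and `M` an
`R`-module.  If `f = r₁ • m₁ + ⋯ + r_s • m_s` and the map `R → F^e_* M`, `1 ↦ F^e_* f`, splits
(i.e. there is an `R`-linear `ψ : F^e_* M → R` with `ψ (F^e_* f) = 1`), then for some index `i`
the map `R → F^e_* R`, `1 ↦ F^e_* rᵢ`, splits (there is an `R`-linear `φ : F^e_* R → R` with
`φ (F^e_* rᵢ) = 1`).  `R`-linear maps out of `F^e_* M` are encoded as additive maps `ψ`
satisfying `ψ (c ^ p ^ e • x) = c * ψ x`. -/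
theorem splitting_of_sum_gives_splitting_of_coefficient
    {R M : Type*} [CommRing R] [IsLocalRing R] (p : ℕ) [Fact p.Prime] [CharP R p]
    [AddCommGroup M] [Module R M]
    (e : ℕ) (he : 1 ≤ e) (s : ℕ) (r : Fin s → R) (m : Fin s → M) (f : M)
    (hf : f = ∑ i, r i • m i)
    (ψ : M →+ R) (hψ : ∀ (c : R) (x : M), ψ (c ^ p ^ e • x) = c * ψ x)
    (hψf : ψ f = 1) :
    ∃ i, ∃ φ : R →+ R, (∀ c x : R, φ (c ^ p ^ e * x) = c * φ x) ∧ φ (r i) = 1 := by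
  have hsum : ∑ i, ψ (r i • m i) = 1 := by rw [← map_sum, ← hf, hψf]
  obtain ⟨i, hi⟩ : ∃ i, IsUnit (ψ (r i • m i)) := by
    by_contra! h
    have hmem : (1 : R) ∈ IsLocalRing.maximalIdeal R :=
      hsum ▸ Ideal.sum_mem _ fun i _ => (IsLocalRing.mem_maximalIdeal _).2 (h i)
    exact (IsLocalRing.mem_maximalIdeal _).1 hmem isUnit_one
  obtain ⟨v, hv⟩ := hi.exists_left_inv
  refine ⟨i, (AddMonoidHom.mulLeft v).comp
    (ψ.comp (LinearMap.toSpanSingleton R M (m i)).toAddMonoidHom), fun c x => ?_, ?_⟩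
  · simp [mul_smul, hψ, mul_left_comm]
  · simpa using hv
end

section
/- Let S = ⊕_{n≥0} S_n be a commutative ℕ-graded ring whose irrelevant ideal S_+ = ⊕_{n>0} S_n is generated by homogeneous elements of degree at most d, where d ≥ 1. Then for all integers t ≥ 1 and m ≥ d·t, every homogeneous element of degree m lies in (S_+)^t, i.e., S_m ⊆ (S_+)^t. -/
open DirectSum in
/-- If every homogeneous element of degree at least `k` lies in `J`, and `G` consists of homogeneous elements
of degree at most `d`, then components of elements of `span G` in degree at least `k + d`
lie in `J * span G`. -/
theorem Ideal.decompose_mem_mul_of_mem_span {S : Type*} [CommRing S] (𝒜 : ℕ → AddSubgroup S)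
    [GradedRing 𝒜] {d k m : ℕ} {G : Set S} (hG : ∀ g ∈ G, ∃ n ≤ d, g ∈ 𝒜 n) {J : Ideal S}
    (hJ : ∀ n, k ≤ n → ∀ x ∈ 𝒜 n, x ∈ J) (hm : k + d ≤ m) {y : S} (hy : y ∈ Ideal.span G) :
    (decompose 𝒜 y m : S) ∈ J * Ideal.span G := by
  suffices ∀ a : S, (decompose 𝒜 (a * y) m : S) ∈ J * Ideal.span G by simpa using this 1
  induction hy using Submodule.span_induction with
  | mem g hg =>
    intro a
    obtain ⟨n, hn, hgn⟩ := hG g hg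
    rw [coe_decompose_mul_of_right_mem_of_le 𝒜 hgn (by omega)]
    exact Ideal.mul_mem_mul (hJ (m - n) (by omega) _ (SetLike.coe_mem _)) (Ideal.subset_span hg)
  | zero => simp
  | add y z _ _ hy hz =>
    intro a
    rw [mul_add, decompose_add, DirectSum.add_apply, AddSubgroup.coe_add]
    exact add_mem (hy a) (hz a)
  | smul b y _ hy =>
    intro a
    rw [smul_eq_mul, ← mul_assoc]
    exact hy (a * b)

/-- Let `S = ⊕_{n≥0} S_n` be a commutative ℕ-graded ring whose irrelevant ideal
`S₊ = ⊕_{n>0} S_n` is generated by homogeneous elements of degree at most `d` (`d ≥ 1`).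
Then for all `t ≥ 1` and `m ≥ d·t`, every homogeneous element of degree `m` lies in `S₊^t`. -/
theorem homogeneous_of_large_degree_mem_pow_irrelevant
    {S : Type*} [CommRing S] (𝒜 : ℕ → AddSubgroup S) [GradedRing 𝒜]
    (d : ℕ) (hd : 1 ≤ d)
    (hgen : ∃ G : Set S, (∀ g ∈ G, ∃ n ≤ d, g ∈ 𝒜 n) ∧
      Ideal.span G = (HomogeneousIdeal.irrelevant 𝒜).toIdeal) :
    ∀ t : ℕ, 1 ≤ t → ∀ m : ℕ, d * t ≤ m → ∀ x ∈ 𝒜 m,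
      x ∈ (HomogeneousIdeal.irrelevant 𝒜).toIdeal ^ t := by
  obtain ⟨G, hG, hspan⟩ := hgen
  intro t _
  clear * - hd hG hspan
  induction t with
  | zero => simp
  | succ t ih =>
    intro m hm x hx
    rw [mul_add_one] at hm
    have hxG : x ∈ Ideal.span G :=
      hspan ▸ HomogeneousIdeal.mem_irrelevant_of_mem 𝒜 (by omega) hx
    have h := Ideal.decompose_mem_mul_of_mem_span 𝒜 hG ih hm hxG
    rwa [DirectSum.decompose_of_mem_same 𝒜 hx, hspan, ← pow_succ] at h
end
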